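/- arXiv:2405.08561 — 4 statements merged into one kernel-verified Lean document; each statement's English description precedes it below -/
import Mathlib

section
/- (Mhaskar–Rakhmanov–Saff theorem for sums of translates, due to Sz. Gy. Révész) Let K be a monotone kernel function, R > 0, n ∈ ℕ, and let J be an n-field function on ℝ that is R-admissible for K. Then there exists q = q(K, J, R) > 0 such that for every choice of positive numbers r₁,…,rₙ with r₁ + … + rₙ ≤ R and for all y ∈ S^∞, one has sup_{t∈ℝ} F(y,t) = sup_{t∈[−q,q]} F(y,t). -/
open Filter Set Topology

noncomputable section

/-- A kernel function: finite on `ℝ \ {0}`, concave on `(-∞,0)` and `(0,∞)`,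
with equal one-sided limits at `0`, equal to `K 0` (real or `⊥`). -/
def IsKernel (K : ℝ → EReal) : Prop :=
  (∀ t : ℝ, t ≠ 0 → K t ≠ ⊥ ∧ K t ≠ ⊤) ∧
  ConcaveOn ℝ (Iio (0:ℝ)) (fun t => (K t).toReal) ∧
  ConcaveOn ℝ (Ioi (0:ℝ)) (fun t => (K t).toReal) ∧
  K 0 ≠ ⊤ ∧
  Tendsto K (𝓝[<] (0:ℝ)) (𝓝 (K 0)) ∧
  Tendsto K (𝓝[>] (0:ℝ)) (𝓝 (K 0))

/-- A monotone kernel: nonincreasing on `(-∞,0)`, nondecreasing on `(0,∞)`. -/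
def MonotoneKernel (K : ℝ → EReal) : Prop :=
  IsKernel K ∧ AntitoneOn K (Iio (0:ℝ)) ∧ MonotoneOn K (Ioi (0:ℝ))

/-- An `n`-field function on `ℝ`: bounded above, finite at more than `n` points. -/
def IsFieldFn (n : ℕ) (J : ℝ → EReal) : Prop :=
  (∃ c : ℝ, ∀ t, J t ≤ (c : EReal)) ∧
  (∃ S : Finset ℝ, n < S.card ∧ ∀ x ∈ S, J x ≠ ⊥)

/-- `J` is `R`-admissible for `K`: `J(t) + R·K(t) → -∞` as `|t| → ∞`. -/
def IsAdmissible (K J : ℝ → EReal) (R : ℝ) : Prop :=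
  Tendsto (fun t => J t + (R : EReal) * K t) (cocompact ℝ) (𝓝 ⊥)

/-- The sum of translates function `F(y,t) = J(t) + ∑ rⱼ K(t - yⱼ)`. -/
def SumTrans (K J : ℝ → EReal) {n : ℕ} (r y : Fin n → ℝ) (t : ℝ) : EReal :=
  J t + ∑ j, (r j : EReal) * K (t - y j)

/-- For monotone `y`, `cell y j` is `[y_j, y_{j+1}]` (with `y_0 = -∞`, `y_{n+1} = ∞`). -/
def cell {n : ℕ} (y : Fin n → ℝ) (j : Fin (n+1)) : Set ℝ :=
  {t | (∀ i : Fin n, (i : ℕ) < (j : ℕ) → y i ≤ t) ∧ (∀ i : Fin n, (j : ℕ) ≤ (i : ℕ) → t ≤ y i)}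

/-- The local maximum `mⱼ(y)` over the `j`-th cell. -/
def mloc (K J : ℝ → EReal) {n : ℕ} (r y : Fin n → ℝ) (j : Fin (n+1)) : EReal :=
  sSup (SumTrans K J r y '' cell y j)

/-- The local maximum `mⱼ^b(y)` over the `j`-th cell intersected with `[-b,b]`. -/
def mlocSeg (K J : ℝ → EReal) {n : ℕ} (r y : Fin n → ℝ) (b : ℝ) (j : Fin (n+1)) : EReal :=
  sSup (SumTrans K J r y '' (cell y j ∩ Icc (-b) b))

/-- `q` has the Mhaskar–Rakhmanov–Saff property for `(K, J, R)` (with `n` nodes). -/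
def HasMRS (K J : ℝ → EReal) (R : ℝ) (n : ℕ) (q : ℝ) : Prop :=
  ∀ r : Fin n → ℝ, (∀ j, 0 < r j) → (∑ j, r j) ≤ R →
    ∀ y : Fin n → ℝ, Monotone y →
      sSup (range (SumTrans K J r y)) = sSup (SumTrans K J r y '' Icc (-q) q)

theorem ConcaveOn.add_sub_le_add_sub {s : Set ℝ} {f : ℝ → ℝ} (hf : ConcaveOn ℝ s f)
    {a u h : ℝ} (ha : a ∈ s) (hu : u + h ∈ s) (hau : a ≤ u) (hh : 0 ≤ h) :
    f (u + h) - f u ≤ f (a + h) - f a := by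
  rcases (show 0 ≤ u + h - a by linarith).eq_or_lt with hD | hD
  · have h1 : u = a := by linarith
    simp [h1]
  have hw : 0 ≤ (u - a) / (u + h - a) := div_nonneg (by linarith) hD.le
  have hv : 0 ≤ h / (u + h - a) := div_nonneg hh hD.le
  have hwv : (u - a) / (u + h - a) + h / (u + h - a) = 1 := by field_simp; ring
  have h1 := hf.2 ha hu hv hw (by linarith)
  have h2 := hf.2 ha hu hw hv hwv
  have e1 : h / (u + h - a) * a + (u - a) / (u + h - a) * (u + h) = u := by field_simp; ring
  have e2 : (u - a) / (u + h - a) * a + h / (u + h - a) * (u + h) = a + h := by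
    field_simp; ring
  simp only [smul_eq_mul, e1, e2] at h1 h2
  have e3 : (u - a) / (u + h - a) * f a + h / (u + h - a) * f a = f a := by
    rw [← add_mul, hwv, one_mul]
  have e4 : (u - a) / (u + h - a) * f (u + h) + h / (u + h - a) * f (u + h) = f (u + h) := by
    rw [← add_mul, hwv, one_mul]
  linarith

/-- Translating a monotone concave kernel changes it, relative to its value at a point `x`
separated from the node, by at most `k t + C` for large positive `t`. -/
theorem exists_translate_le {k : ℝ → ℝ} (hc : ConcaveOn ℝ (Ioi 0) k)
    (hanti : AntitoneOn k (Iio 0)) (hmono : MonotoneOn k (Ioi 0))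
    (x : ℝ) {δ : ℝ} (hδ : 0 < δ) :
    ∃ C : ℝ, ∀ t, 1 + |x| < t → 0 ≤ k t + C ∧
      ∀ y, δ ≤ |x - y| → t ≠ y → k (t - y) ≤ k (x - y) + (k t + C) := by
  have hx := abs_nonneg x
  have hx1 := le_abs_self x
  have hx2 := neg_abs_le x
  have hk1 : k 1 ≤ k (1 + (|x| + δ)) :=
    hmono (mem_Ioi.2 one_pos) (mem_Ioi.2 (by linarith)) (by linarith)
  refine ⟨k (1 + (|x| + δ)) - k 1 + |k δ| + |k (-δ)| + |k 1|, fun t ht => ?_⟩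
  have hkt : k 1 ≤ k t := hmono (mem_Ioi.2 one_pos) (mem_Ioi.2 (by linarith)) (by linarith)
  have a1 := neg_abs_le (k 1)
  have a2 := neg_abs_le (k δ)
  have a3 := neg_abs_le (k (-δ))
  have b1 := abs_nonneg (k 1)
  have b2 := abs_nonneg (k δ)
  have b3 := abs_nonneg (k (-δ))
  have hnn : 0 ≤ k t + (k (1 + (|x| + δ)) - k 1 + |k δ| + |k (-δ)| + |k 1|) := by linarith
  refine ⟨hnn, fun y hy hty => ?_⟩
  have hinc : k (t + (|x| + δ)) - k t ≤ k (1 + (|x| + δ)) - k 1 :=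
    hc.add_sub_le_add_sub (mem_Ioi.2 one_pos) (mem_Ioi.2 (by linarith)) (by linarith)
      (by linarith)
  rcases le_abs.1 hy with hxy | hxy
  · have h1 := hc.add_sub_le_add_sub (a := δ) (u := x - y) (h := t - x) (mem_Ioi.2 hδ)
      (mem_Ioi.2 (by linarith)) hxy (by linarith)
    rw [show x - y + (t - x) = t - y by ring] at h1
    have h2 : k (δ + (t - x)) ≤ k (t + (|x| + δ)) :=
      hmono (mem_Ioi.2 (by linarith)) (mem_Ioi.2 (by linarith)) (by linarith)
    linarith
  · rcases lt_or_gt_of_ne hty with h | h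
    · have h1 : k (t - y) ≤ k (x - y) :=
        hanti (mem_Iio.2 (by linarith)) (mem_Iio.2 (by linarith)) (by linarith)
      linarith
    · have h1 : k (-δ) ≤ k (x - y) :=
        hanti (mem_Iio.2 (by linarith)) (mem_Iio.2 (by linarith)) (by linarith)
      have h2 : k (t - y) ≤ k (t + (|x| + δ)) :=
        hmono (mem_Ioi.2 (by linarith)) (mem_Ioi.2 (by linarith)) (by linarith)
      linarith

theorem IsKernel.coe_toReal {K : ℝ → EReal} (hK : IsKernel K) {t : ℝ} (ht : t ≠ 0) :
    ((K t).toReal : EReal) = K t :=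
  EReal.coe_toReal (hK.1 t ht).2 (hK.1 t ht).1

theorem MonotoneKernel.apply_zero_le {K : ℝ → EReal} (hK : MonotoneKernel K) {s : ℝ}
    (hs : s ≠ 0) : K 0 ≤ K s := by
  obtain ⟨⟨-, -, -, -, hl, hr⟩, hanti, hmono⟩ := hK
  rcases lt_or_gt_of_ne hs with h | h
  · refine le_of_tendsto hl ?_
    filter_upwards [Ioo_mem_nhdsLT h] with u hu
    exact hanti h hu.2 hu.1.le
  · refine le_of_tendsto hr ?_
    filter_upwards [Ioo_mem_nhdsGT h] with u hu
    exact hmono hu.1 h hu.2.le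

theorem MonotoneKernel.exists_translate_le {K : ℝ → EReal} (hK : MonotoneKernel K)
    (x : ℝ) {δ : ℝ} (hδ : 0 < δ) :
    ∃ C : ℝ, ∀ t, 1 + |x| < |t| → 0 ≤ (K t).toReal + C ∧
      ∀ y, δ ≤ |x - y| →
        K (t - y) ≤ (((K (x - y)).toReal + ((K t).toReal + C) : ℝ) : EReal) := by
  have hanti : AntitoneOn (fun t => (K t).toReal) (Iio 0) := fun a ha b hb hab =>
    EReal.toReal_le_toReal (hK.2.1 ha hb hab) (hK.1.1 b hb.ne).1 (hK.1.1 a ha.ne).2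
  have hmono : MonotoneOn (fun t => (K t).toReal) (Ioi 0) := fun a ha b hb hab =>
    EReal.toReal_le_toReal (hK.2.2 ha hb hab) (hK.1.1 a ha.ne').1 (hK.1.1 b hb.ne').2
  obtain ⟨C₁, h₁⟩ := _root_.exists_translate_le hK.1.2.2.1 hanti hmono x hδ
  have hc' : ConcaveOn ℝ (Ioi (0 : ℝ)) (fun t => (K (-t)).toReal) := by
    refine ⟨convex_Ioi 0, fun a ha b hb p q hp hq hpq => ?_⟩
    have := hK.1.2.1.2 (mem_Iio.2 (neg_lt_zero.2 (mem_Ioi.1 ha)))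
      (mem_Iio.2 (neg_lt_zero.2 (mem_Ioi.1 hb))) hp hq hpq
    simpa only [smul_neg, ← neg_add] using this
  obtain ⟨C₂, h₂⟩ := _root_.exists_translate_le (k := fun t => (K (-t)).toReal) hc'
    (fun a ha b hb hab => hmono (mem_Ioi.2 (neg_pos.2 (mem_Iio.1 hb)))
      (mem_Ioi.2 (neg_pos.2 (mem_Iio.1 ha))) (neg_le_neg hab))
    (fun a ha b hb hab => hanti (mem_Iio.2 (neg_lt_zero.2 (mem_Ioi.1 hb)))
      (mem_Iio.2 (neg_lt_zero.2 (mem_Ioi.1 ha))) (neg_le_neg hab)) (-x) hδ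
  have key : ∀ t, 1 + |x| < |t| → 0 ≤ (K t).toReal + max C₁ C₂ ∧
      ∀ y, δ ≤ |x - y| → t ≠ y →
        (K (t - y)).toReal ≤ (K (x - y)).toReal + ((K t).toReal + max C₁ C₂) := by
    intro t ht
    have m1 := le_max_left C₁ C₂
    have m2 := le_max_right C₁ C₂
    rcases lt_abs.1 ht with h | h
    · obtain ⟨h0, h1⟩ := h₁ t h
      refine ⟨by linarith, fun y hy hty => ?_⟩
      have := h1 y hy hty
      linarith
    · obtain ⟨h0, h1⟩ := h₂ (-t) (by rwa [abs_neg])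
      simp only [neg_neg] at h0 h1
      refine ⟨by linarith, fun y hy hty => ?_⟩
      have := h1 (-y) (by rwa [← abs_neg, show -(-x - -y) = x - y by ring])
        (fun h => hty (neg_injective h))
      rw [show -(-t - -y) = t - y by ring, show -(-x - -y) = x - y by ring] at this
      linarith
  refine ⟨max C₁ C₂, fun t ht => ⟨(key t ht).1, fun y hy => ?_⟩⟩
  have hxy : x - y ≠ 0 := abs_pos.1 (hδ.trans_le hy)
  rcases eq_or_ne t y with rfl | hty
  · rw [sub_self]
    refine (hK.apply_zero_le hxy).trans ?_
    rw [← hK.1.coe_toReal hxy, EReal.coe_le_coe_iff, EReal.toReal_coe]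
    linarith [(key t ht).1]
  · rw [← hK.1.coe_toReal (sub_ne_zero.2 hty), EReal.coe_le_coe_iff]
    exact (key t ht).2 y hy hty

theorem EReal.coe_sum {ι : Type*} (s : Finset ι) (f : ι → ℝ) :
    ((∑ i ∈ s, f i : ℝ) : EReal) = ∑ i ∈ s, (f i : EReal) :=
  map_sum (AddMonoidHom.mk ⟨((↑) : ℝ → EReal), EReal.coe_zero⟩ EReal.coe_add) f s

theorem SumTrans_eq_coe {K J : ℝ → EReal} (hK : IsKernel K) {n : ℕ} (r y : Fin n → ℝ) {x : ℝ}
    (hx : ∀ j, x ≠ y j) :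
    SumTrans K J r y x = J x + ((∑ j, r j * (K (x - y j)).toReal : ℝ) : EReal) := by
  rw [SumTrans, EReal.coe_sum]
  congr 1
  refine Finset.sum_congr rfl fun j _ => ?_
  rw [EReal.coe_mul, hK.coe_toReal (sub_ne_zero.2 (hx j))]

theorem MonotoneKernel.eventually_SumTrans_le {K J : ℝ → EReal} (hK : MonotoneKernel K) {R : ℝ}
    (hadm : IsAdmissible K J R) (n : ℕ) {x : ℝ} (hJ : J x ≠ ⊥) {δ : ℝ} (hδ : 0 < δ) :
    ∀ᶠ t in cocompact ℝ, ∀ r y : Fin n → ℝ, (∀ j, 0 < r j) → ∑ j, r j ≤ R →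
      (∀ j, δ ≤ |x - y j|) → SumTrans K J r y t ≤ SumTrans K J r y x := by
  obtain ⟨C, hC⟩ := hK.exists_translate_le x hδ
  obtain ⟨b, -, hb⟩ := EReal.lt_iff_exists_real_btwn.1 (bot_lt_iff_ne_bot.2 hJ)
  have hlarge : ∀ᶠ t : ℝ in cocompact ℝ, 1 + |x| < |t| :=
    (tendsto_norm_cocompact_atTop (E := ℝ)).eventually_gt_atTop (1 + |x|)
  filter_upwards [hlarge, hadm.eventually_lt_const (EReal.bot_lt_coe (b - R * C))]
    with t ht hJt r y hr hrR hy
  obtain ⟨h0, h1⟩ := hC t ht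
  have ht0 : t ≠ 0 := by
    rintro rfl
    rw [abs_zero] at ht
    linarith [abs_nonneg x]
  have hxy : ∀ j, x ≠ y j := fun j => sub_ne_zero.1 (abs_pos.1 (hδ.trans_le (hy j)))
  rw [SumTrans_eq_coe hK.1 r y hxy]
  set A := ∑ j, r j * (K (x - y j)).toReal with hA
  have hsum : ∑ j, (r j : EReal) * K (t - y j) ≤
      ((R * (K t).toReal + (A + R * C) : ℝ) : EReal) := by
    calc ∑ j, (r j : EReal) * K (t - y j)
        ≤ ∑ j, ((r j * ((K (x - y j)).toReal + ((K t).toReal + C)) : ℝ) : EReal) := by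
          refine Finset.sum_le_sum fun j _ => ?_
          rw [EReal.coe_mul]
          exact mul_le_mul_of_nonneg_left (h1 (y j) (hy j)) (EReal.coe_nonneg.2 (hr j).le)
      _ = ((∑ j, r j * ((K (x - y j)).toReal + ((K t).toReal + C)) : ℝ) : EReal) :=
          (EReal.coe_sum _ _).symm
      _ ≤ _ := by
          rw [EReal.coe_le_coe_iff]
          simp only [mul_add (r _) (K (x - y _)).toReal, Finset.sum_add_distrib, ← Finset.sum_mul]
          have := mul_le_mul_of_nonneg_right hrR h0
          linarith
  calc SumTrans K J r y t ≤ J t + ((R * (K t).toReal + (A + R * C) : ℝ) : EReal) :=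
        add_le_add le_rfl hsum
    _ = (J t + (R : EReal) * K t) + ((A + R * C : ℝ) : EReal) := by
        rw [EReal.coe_add, ← add_assoc, EReal.coe_mul, hK.1.coe_toReal ht0]
    _ ≤ ((b - R * C : ℝ) : EReal) + ((A + R * C : ℝ) : EReal) := add_le_add hJt.le le_rfl
    _ = (b : EReal) + (A : EReal) := by
        rw [← EReal.coe_add, ← EReal.coe_add]
        congr 1
        ring
    _ ≤ J x + (A : EReal) := add_le_add hb.le le_rfl

theorem Finset.exists_pos_le_abs_sub (S : Finset ℝ) :
    ∃ δ : ℝ, 0 < δ ∧ ∀ a ∈ S, ∀ b ∈ S, a ≠ b → 2 * δ ≤ |a - b| := by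
  have h : ∀ᶠ δ : ℝ in 𝓝[>] 0, ∀ p ∈ S.offDiag, 2 * δ ≤ |p.1 - p.2| := by
    refine (Filter.eventually_all_finset _).2 fun p hp => ?_
    have hp' : 0 < |p.1 - p.2| := abs_pos.2 (sub_ne_zero.2 (Finset.mem_offDiag.1 hp).2.2)
    filter_upwards [Ioo_mem_nhdsGT (half_pos hp')] with δ hδ
    linarith [hδ.2]
  obtain ⟨δ, hδ, hpos⟩ := (h.and self_mem_nhdsWithin).exists
  exact ⟨δ, hpos, fun a ha b hb hab => hδ (a, b) (Finset.mem_offDiag.2 ⟨ha, hb, hab⟩)⟩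

/-- Among more than `n` separated points, one is far from each of `n` given nodes. -/
theorem Finset.exists_forall_le_abs_sub {S : Finset ℝ} {n : ℕ} (hS : n < S.card) {δ : ℝ}
    (hδ : ∀ a ∈ S, ∀ b ∈ S, a ≠ b → 2 * δ ≤ |a - b|) (y : Fin n → ℝ) :
    ∃ x ∈ S, ∀ j, δ ≤ |x - y j| := by
  by_contra! h
  obtain ⟨a₀, ha₀⟩ := Finset.card_pos.1 (n.zero_le.trans_lt hS)
  obtain ⟨j₀, -⟩ := h a₀ ha₀
  have : Nonempty (Fin n) := ⟨j₀⟩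
  choose! f hf using h
  obtain ⟨a, ha, b, hb, hab, hfab⟩ := Finset.exists_ne_map_eq_of_card_lt_of_maps_to
    (s := S) (t := Finset.univ) (by simpa using hS) (f := f) (fun _ _ => by simp)
  have h1 := hf a ha
  have h2 := hf b hb
  rw [← hfab, abs_sub_comm] at h2
  have h3 := abs_sub_le a (y (f a)) b
  linarith [hδ a ha b hb hab]

/-- Mhaskar–Rakhmanov–Saff theorem for sums of translates,
Sz. Gy. Révész: there exists `q = q(K, J, R) > 0` such that for all positive
`r₁,…,rₙ` with `∑ rⱼ ≤ R` and all `y ∈ S^∞`,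
`sup_{t ∈ ℝ} F(y,t) = sup_{t ∈ [-q,q]} F(y,t)`. -/
theorem MRS_exists (K J : ℝ → EReal) (hK : MonotoneKernel K) (R : ℝ) (hR : 0 < R)
    (n : ℕ) (hn : 0 < n) (hJ : IsFieldFn n J) (hadm : IsAdmissible K J R) :
    ∃ q : ℝ, 0 < q ∧ HasMRS K J R n q := by
  obtain ⟨-, S, hS, hSJ⟩ := hJ
  obtain ⟨δ, hδ, hsep⟩ := S.exists_pos_le_abs_sub
  have hev := (Filter.eventually_all_finset S).2 fun x hx =>
    hK.eventually_SumTrans_le hadm n (hSJ x hx) hδ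
  obtain ⟨q₀, hq₀⟩ := Metric.closedBall_compl_subset_of_mem_cocompact hev (0 : ℝ)
  obtain ⟨q, hqS, hq, hqq₀⟩ := (((Filter.eventually_all_finset S).2 fun x _ =>
    eventually_ge_atTop |x|).and ((eventually_gt_atTop 0).and (eventually_ge_atTop q₀))).exists
  refine ⟨q, hq, fun r hr hrR y _ => le_antisymm (sSup_le ?_)
    (sSup_le_sSup (image_subset_range _ _))⟩
  rintro _ ⟨t, rfl⟩
  by_cases ht : t ∈ Icc (-q) q
  · exact le_sSup (mem_image_of_mem _ ht)
  obtain ⟨x, hxS, hx⟩ := Finset.exists_forall_le_abs_sub hS hsep y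
  have htq : q < |t| := by
    by_contra! h
    exact ht (abs_le.1 h)
  refine (hq₀ ?_ x hxS r y hr hrR hx).trans
    (le_sSup (mem_image_of_mem _ (abs_le.1 (hqS x hxS))))
  simpa using hqq₀.trans_lt htq
end
end

section
/- Let K be a monotone kernel function, n ∈ ℕ, r₁,…,rₙ > 0 with R := r₁ + … + rₙ, let J be an n-field function on ℝ that is R-admissible for K, and let q > 0 have the Mhaskar–Rakhmanov–Saff property for (K, J, R). If ℓ ≥ q and w ∈ S^ℓ is an equioscillation point on [−ℓ,ℓ] (i.e., m₀^ℓ(w) = … = mₙ^ℓ(w)), then mⱼ(w) = mⱼ^ℓ(w) for all j = 0,…,n; in particular, w is an equioscillation point on ℝ. -/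
open Filter Set Topology

noncomputable section

/-- The cells of a monotone node vector cover the real line. -/
theorem exists_mem_cell {n : ℕ} {y : Fin n → ℝ} (hy : Monotone y) (t : ℝ) :
    ∃ j, t ∈ cell y j := by
  classical
  have hn : ∀ i : Fin n, n ≤ (i : ℕ) → t ≤ y i := fun i hi => absurd i.isLt hi.not_gt
  have h : ∃ k : ℕ, ∀ i : Fin n, k ≤ (i : ℕ) → t ≤ y i := ⟨n, hn⟩
  refine ⟨⟨Nat.find h, Nat.lt_succ_of_le (Nat.find_min' h hn)⟩, fun i hi => ?_, Nat.find_spec h⟩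
  have hmin := Nat.find_min h hi
  push Not at hmin
  obtain ⟨i', hii', hlt⟩ := hmin
  exact (hy hii').trans hlt.le

/-- if `q` has the MRS property, `ℓ ≥ q` and `w ∈ S^ℓ` is an
equioscillation point on `[-ℓ, ℓ]`, then `mⱼ(w) = mⱼ^ℓ(w)` for all `j`; in particular
`w` is an equioscillation point on `ℝ`. -/
theorem equioscillation_extends (K J : ℝ → EReal) (hK : MonotoneKernel K)
    (n : ℕ) (hn : 0 < n) (r : Fin n → ℝ) (hr : ∀ j, 0 < r j)
    (hJ : IsFieldFn n J) (hadm : IsAdmissible K J (∑ j, r j))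
    (q : ℝ) (hq : 0 < q) (hMRS : HasMRS K J (∑ j, r j) n q)
    (ℓ : ℝ) (hℓ : q ≤ ℓ)
    (w : Fin n → ℝ) (hwmono : Monotone w) (hwS : ∀ j, w j ∈ Icc (-ℓ) ℓ)
    (hequi : ∀ j j' : Fin (n + 1), mlocSeg K J r w ℓ j = mlocSeg K J r w ℓ j') :
    (∀ j : Fin (n + 1), mloc K J r w j = mlocSeg K J r w ℓ j) ∧
    (∀ j j' : Fin (n + 1), mloc K J r w j = mloc K J r w j') := by
  have hseg : ∀ j, mloc K J r w j = mlocSeg K J r w ℓ j := by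
    intro j
    apply le_antisymm
    · calc mloc K J r w j ≤ sSup (range (SumTrans K J r w)) :=
            sSup_le_sSup (image_subset_range _ _)
        _ = sSup (SumTrans K J r w '' Icc (-q) q) := hMRS r hr le_rfl w hwmono
        _ ≤ mlocSeg K J r w ℓ j := by
            apply sSup_le
            rintro _ ⟨t, ht, rfl⟩
            obtain ⟨j', hj'⟩ := exists_mem_cell hwmono t
            rw [hequi j j']
            exact le_sSup ⟨t, ⟨hj', Icc_subset_Icc (neg_le_neg hℓ) hℓ ht⟩, rfl⟩
    · exact sSup_le_sSup (image_mono inter_subset_left)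
  exact ⟨hseg, fun j j' => by rw [hseg, hseg, hequi]⟩
end
end

section
/- Let K be a monotone kernel function, n ∈ ℕ, r₁,…,rₙ > 0 with R := r₁ + … + rₙ, let J be an n-field function on ℝ that is R-admissible for K, and let q > 0 have the Mhaskar–Rakhmanov–Saff property for (K, J, R). If ℓ ≥ q and y ∈ S^∞ \ S^ℓ, define y' ∈ S^ℓ by y'ⱼ := −ℓ if yⱼ < −ℓ, y'ⱼ := yⱼ if yⱼ ∈ [−ℓ,ℓ], and y'ⱼ := ℓ if yⱼ > ℓ. Then sup_{t∈ℝ} F(y',t) ≤ sup_{t∈ℝ} F(y,t). -/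
open Filter Set Topology

noncomputable section

namespace MonotoneKernel

variable {K : ℝ → EReal}

lemma antitoneOn_Iic (hK : MonotoneKernel K) : AntitoneOn K (Iic (0:ℝ)) := by
  obtain ⟨⟨-, -, -, -, hleft, -⟩, hanti, -⟩ := hK
  intro a _ b hb hab
  rcases (mem_Iic.mp hb).lt_or_eq with hb0 | rfl
  · exact hanti (hab.trans_lt hb0) hb0 hab
  rcases hab.lt_or_eq with ha0 | rfl
  · refine le_of_tendsto hleft ?_
    filter_upwards [Ioo_mem_nhdsLT ha0] with u hu
    exact hanti ha0 hu.2 hu.1.le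
  · exact le_rfl

lemma monotoneOn_Ici (hK : MonotoneKernel K) : MonotoneOn K (Ici (0:ℝ)) := by
  obtain ⟨⟨-, -, -, -, -, hright⟩, -, hmono⟩ := hK
  intro a ha b _ hab
  rcases (mem_Ici.mp ha).lt_or_eq with ha0 | rfl
  · exact hmono ha0 (ha0.trans_le hab) hab
  rcases hab.lt_or_eq with hb0 | rfl
  · refine le_of_tendsto hright ?_
    filter_upwards [Ioo_mem_nhdsGT hb0] with u hu
    exact hmono hu.1 hb0 hu.2.le
  · exact le_rfl

/-- Clamping a node to `[-ℓ, ℓ]` decreases the translated kernel on `[-ℓ, ℓ]`. -/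
lemma sub_clamp_le (hK : MonotoneKernel K) {ℓ t : ℝ} (ht : t ∈ Icc (-ℓ) ℓ) (x : ℝ) :
    K (t - max (-ℓ) (min x ℓ)) ≤ K (t - x) := by
  obtain ⟨ht1, ht2⟩ := ht
  rcases lt_or_ge x (-ℓ) with h1 | h1
  · rw [min_eq_left (by linarith), max_eq_left h1.le]
    exact hK.monotoneOn_Ici (mem_Ici.mpr (by linarith)) (mem_Ici.mpr (by linarith))
      (by linarith)
  rcases le_or_gt x ℓ with h2 | h2
  · rw [min_eq_left h2, max_eq_right h1]
  · rw [min_eq_right h2.le, max_eq_right (by linarith)]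
    exact hK.antitoneOn_Iic (mem_Iic.mpr (by linarith)) (mem_Iic.mpr (by linarith))
      (by linarith)

end MonotoneKernel

/-- if `q` has the MRS property, `ℓ ≥ q` and `y ∈ S^∞ \ S^ℓ`, then
clamping the nodes of `y` to `[-ℓ, ℓ]` does not increase the global supremum of the
sum of translates. -/
theorem clamp_decreases_sup (K J : ℝ → EReal) (hK : MonotoneKernel K)
    (n : ℕ) (hn : 0 < n) (r : Fin n → ℝ) (hr : ∀ j, 0 < r j)
    (hJ : IsFieldFn n J) (hadm : IsAdmissible K J (∑ j, r j))
    (q : ℝ) (hq : 0 < q) (hMRS : HasMRS K J (∑ j, r j) n q)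
    (ℓ : ℝ) (hℓ : q ≤ ℓ)
    (y : Fin n → ℝ) (hy : Monotone y) (hyout : ¬ ∀ j, y j ∈ Icc (-ℓ) ℓ) :
    sSup (range (SumTrans K J r (fun j => max (-ℓ) (min (y j) ℓ)))) ≤
      sSup (range (SumTrans K J r y)) := by
  have hmono : Monotone fun j => max (-ℓ) (min (y j) ℓ) := fun i j hij =>
    max_le_max le_rfl (min_le_min (hy hij) le_rfl)
  rw [hMRS r hr le_rfl _ hmono]
  refine sSup_le ?_
  rintro _ ⟨t, ht, rfl⟩
  refine le_trans ?_ (le_sSup (mem_range_self t))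
  refine add_le_add le_rfl (Finset.sum_le_sum fun j _ => ?_)
  exact mul_le_mul_of_nonneg_left
    (hK.sub_clamp_le ⟨(neg_le_neg hℓ).trans ht.1, ht.2.trans hℓ⟩ (y j))
    (EReal.coe_nonneg.mpr (hr j).le)
end
end

section
/- Let K be a monotone kernel function, n ∈ ℕ, r₁,…,rₙ > 0 with R := r₁ + … + rₙ, and let J be an n-field function on ℝ that is R-admissible for K. Then there exists a point w ∈ S^∞ such that m̄(w) = M(S^∞), i.e., the infimum over S^∞ of the maximum of the sum of translates function is attained. -/
open Filter Set Topology

noncomputable section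

namespace MonotoneKernel

variable {K : ℝ → EReal}

lemma comp_neg (hK : MonotoneKernel K) : MonotoneKernel (fun t => K (-t)) := by
  obtain ⟨⟨hfin, hneg, hpos, h0, hl, hr⟩, hanti, hmono⟩ := hK
  have hL : Tendsto (fun t : ℝ => -t) (𝓝[<] 0) (𝓝[>] 0) := by
    simpa using tendsto_neg_nhdsLT (a := (0 : ℝ))
  have hR : Tendsto (fun t : ℝ => -t) (𝓝[>] 0) (𝓝[<] 0) := by
    simpa using tendsto_neg_nhdsGT (a := (0 : ℝ))
  refine ⟨⟨fun t ht => hfin _ (neg_ne_zero.2 ht), ?_, ?_, by simpa using h0, ?_, ?_⟩, ?_, ?_⟩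
  · refine ⟨convex_Iio 0, fun x hx y hy a b ha hb hab => ?_⟩
    have := hpos.2 (x := -x) (y := -y) (by simpa using hx) (by simpa using hy) ha hb hab
    have e : -(a • x + b • y) = a • (-x) + b • (-y) := by simp; ring
    simpa only [e] using this
  · refine ⟨convex_Ioi 0, fun x hx y hy a b ha hb hab => ?_⟩
    have := hneg.2 (x := -x) (y := -y) (by simpa using hx) (by simpa using hy) ha hb hab
    have e : -(a • x + b • y) = a • (-x) + b • (-y) := by simp; ring
    simpa only [e] using this
  · simpa [Function.comp_def] using hr.comp hL
  · simpa [Function.comp_def] using hl.comp hR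
  · intro x hx y hy hxy
    exact hmono (by simpa using hy) (by simpa using hx) (neg_le_neg hxy)
  · intro x hx y hy hxy
    exact hanti (by simpa using hy) (by simpa using hx) (neg_le_neg hxy)

lemma ne_top (hK : MonotoneKernel K) (t : ℝ) : K t ≠ ⊤ := by
  rcases eq_or_ne t 0 with rfl | ht
  · exact hK.1.2.2.2.1
  · exact (hK.1.1 t ht).2

lemma coe_toReal (hK : MonotoneKernel K) {t : ℝ} (ht : t ≠ 0) : ((K t).toReal : EReal) = K t :=
  EReal.coe_toReal (hK.1.1 t ht).2 (hK.1.1 t ht).1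

lemma le_of_nonneg (hK : MonotoneKernel K) {a b : ℝ} (ha : 0 ≤ a) (hab : a ≤ b) :
    K a ≤ K b := by
  rcases ha.eq_or_lt with rfl | ha
  · rcases hab.eq_or_lt with rfl | hb
    · exact le_rfl
    · refine le_of_tendsto hK.1.2.2.2.2.2 ?_
      filter_upwards [Ioo_mem_nhdsGT hb] with x hx
      exact hK.2.2 hx.1 hb hx.2.le
  · exact hK.2.2 ha (ha.trans_le hab) hab

lemma le_of_nonpos (hK : MonotoneKernel K) {a b : ℝ} (ha : a ≤ 0) (hab : b ≤ a) :
    K a ≤ K b := by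
  simpa using hK.comp_neg.le_of_nonneg (neg_nonneg.2 ha) (neg_le_neg hab)

lemma continuousAt_of_pos (hK : MonotoneKernel K) {t : ℝ} (ht : 0 < t) : ContinuousAt K t := by
  have h := (hK.1.2.2.1.continuousOn isOpen_Ioi).continuousAt (Ioi_mem_nhds ht)
  refine (continuous_coe_real_ereal.continuousAt.comp h).congr ?_
  filter_upwards [Ioi_mem_nhds ht] with x hx
  exact hK.coe_toReal (ne_of_gt hx)

lemma continuous (hK : MonotoneKernel K) : Continuous K := by
  refine continuous_iff_continuousAt.2 fun t => ?_
  rcases lt_trichotomy t 0 with ht | rfl | ht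
  · have h := hK.comp_neg.continuousAt_of_pos (neg_pos.2 ht)
    simpa [Function.comp_def] using
      ContinuousAt.comp (f := fun x : ℝ => -x) (x := t) h continuous_neg.continuousAt
  · exact continuousAt_iff_continuous_left'_right'.2 ⟨hK.1.2.2.2.2.1, hK.1.2.2.2.2.2⟩
  · exact hK.continuousAt_of_pos ht

lemma tail_dichotomy (hK : MonotoneKernel K) (A U : ℝ) :
    ∃ C : ℝ, 0 ≤ C ∧ ∀ x : ℝ,
      (∀ t, 1 ≤ t → 0 ≤ t + x → K (t + x) ≤ (((K t).toReal + C : ℝ) : EReal)) ∨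
      (∀ s, x - A ≤ s → (U : EReal) ≤ K s) := by
  have hmono : ∀ {a b : ℝ}, 0 < a → a ≤ b → (K a).toReal ≤ (K b).toReal := by
    intro a b ha hab
    rw [← EReal.coe_le_coe_iff, hK.coe_toReal ha.ne', hK.coe_toReal (ha.trans_le hab).ne']
    exact hK.le_of_nonneg ha.le hab
  by_cases hb : ∃ D : ℝ, ∀ s, 0 < s → (K s).toReal ≤ D
  · obtain ⟨D, hD⟩ := hb
    refine ⟨D - (K 1).toReal, sub_nonneg.2 (hD 1 one_pos), fun x => Or.inl fun t ht htx => ?_⟩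
    refine (hK.le_of_nonneg htx (le_add_of_nonneg_right zero_le_one)).trans ?_
    rw [← hK.coe_toReal (by positivity : t + x + 1 ≠ 0), EReal.coe_le_coe_iff]
    linarith [hD (t + x + 1) (by positivity), hmono one_pos ht]
  · push Not at hb
    obtain ⟨B, hB, hUB⟩ := hb U
    refine ⟨max 0 ((K (1 + max (B + A) 0)).toReal - (K 1).toReal), le_max_left _ _, fun x => ?_⟩
    rcases le_or_gt x (B + A) with hx | hx
    · refine Or.inl fun t ht htx => ?_
      set z := max (B + A) 0
      have hz : 0 ≤ z := le_max_right _ _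
      have hxz : x ≤ z := hx.trans (le_max_left _ _)
      refine (hK.le_of_nonneg htx (by linarith : t + x ≤ t + z)).trans ?_
      rw [← hK.coe_toReal (by positivity : t + z ≠ 0), EReal.coe_le_coe_iff]
      suffices h : (K (t + z)).toReal - (K t).toReal ≤ (K (1 + z)).toReal - (K 1).toReal by
        linarith [le_max_right (0 : ℝ) ((K (1 + z)).toReal - (K 1).toReal)]
      -- concave functions have decreasing increments
      rcases (add_nonneg (sub_nonneg.2 ht) hz).eq_or_lt with h0 | h0
      · have h1 : t = 1 := by linarith
        rw [h1]
      · have hc := hK.1.2.2.1.2 (x := 1) (y := t + z) (mem_Ioi.2 one_pos)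
          (mem_Ioi.2 (by positivity))
        have e1 := hc (a := (t - 1) / (t - 1 + z)) (b := z / (t - 1 + z))
          (div_nonneg (sub_nonneg.2 ht) h0.le) (by positivity) (by field_simp)
        have e2 := hc (a := z / (t - 1 + z)) (b := (t - 1) / (t - 1 + z))
          (by positivity) (div_nonneg (sub_nonneg.2 ht) h0.le) (by field_simp; ring)
        have r1 : ((t - 1) / (t - 1 + z)) • (1 : ℝ) + (z / (t - 1 + z)) • (t + z) = 1 + z := by
          simp only [smul_eq_mul]; field_simp; ring
        have r2 : (z / (t - 1 + z)) • (1 : ℝ) + ((t - 1) / (t - 1 + z)) • (t + z) = t := by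
          simp only [smul_eq_mul]; field_simp; ring
        have hs : (t - 1) / (t - 1 + z) = 1 - z / (t - 1 + z) := by field_simp; ring
        rw [r1] at e1
        rw [r2] at e2
        simp only [smul_eq_mul, hs] at e1 e2
        linarith
    · refine Or.inr fun s hs => ?_
      have hBs : B ≤ s := by linarith
      refine le_trans ?_ (hK.le_of_nonneg hB.le hBs)
      rw [← hK.coe_toReal hB.ne']
      exact_mod_cast hUB.le

end MonotoneKernel

lemma EReal.sum_coe {ι : Type*} (s : Finset ι) (f : ι → ℝ) :
    ∑ j ∈ s, (f j : EReal) = ((∑ j ∈ s, f j : ℝ) : EReal) :=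
  (map_sum (⟨⟨fun x : ℝ => (x : EReal), rfl⟩, EReal.coe_add⟩ : ℝ →+ EReal) f s).symm

lemma EReal.coe_mul_ne_top_of_pos {r : ℝ} (hr : 0 < r) {x : EReal} (hx : x ≠ ⊤) :
    (r : EReal) * x ≠ ⊤ := by
  induction x with
  | bot => simp [EReal.coe_mul_bot_of_pos hr]
  | coe x => exact_mod_cast EReal.coe_ne_top (r * x)
  | top => exact absurd rfl hx

lemma EReal.continuous_coe_mul_of_pos {r : ℝ} (hr : 0 < r) :
    Continuous (fun x : EReal => (r : EReal) * x) := by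
  have hr0 : (r : EReal) ≠ 0 := by exact_mod_cast hr.ne'
  refine continuous_iff_continuousAt.2 fun x => ?_
  exact (EReal.continuousAt_mul (p := ((r : EReal), x)) (Or.inl hr0) (Or.inl hr0)
    (Or.inl (EReal.coe_ne_bot r)) (Or.inl (EReal.coe_ne_top r))).comp
    (f := fun x : EReal => ((r : EReal), x)) (by fun_prop)

/-- A finite sum of continuous `EReal`-valued functions avoiding `⊤` is continuous. -/
lemma EReal.continuous_sum_of_ne_top {X ι : Type*} [TopologicalSpace X] (s : Finset ι)
    {f : ι → X → EReal} (hf : ∀ i, Continuous (f i)) (htop : ∀ i x, f i x ≠ ⊤) :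
    Continuous (fun x => ∑ i ∈ s, f i x) ∧ ∀ x, ∑ i ∈ s, f i x ≠ ⊤ := by
  classical
  induction s using Finset.induction_on with
  | empty => exact ⟨by simpa using continuous_const, by simp⟩
  | insert a s ha ih =>
    simp only [Finset.sum_insert ha]
    refine ⟨continuous_iff_continuousAt.2 fun x => ?_, fun x => EReal.add_ne_top (htop a x) (ih.2 x)⟩
    exact (EReal.continuousAt_add (p := (f a x, ∑ i ∈ s, f i x)) (Or.inl (htop a x))
      (Or.inr (ih.2 x))).comp
      (f := fun x => (f a x, ∑ i ∈ s, f i x)) ((hf a).prodMk ih.1).continuousAt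

section SumTrans

variable {K J : ℝ → EReal} {n : ℕ} {r : Fin n → ℝ}

lemma continuous_sumTrans (hK : MonotoneKernel K) (hr : ∀ j, 0 < r j) {t : ℝ} (ht : J t ≠ ⊤) :
    Continuous (fun y : Fin n → ℝ => SumTrans K J r y t) := by
  have h := EReal.continuous_sum_of_ne_top (X := Fin n → ℝ) Finset.univ
    (f := fun j y => (r j : EReal) * K (t - y j))
    (fun j => (EReal.continuous_coe_mul_of_pos (hr j)).comp
      (hK.continuous.comp (by fun_prop)))
    (fun j y => EReal.coe_mul_ne_top_of_pos (hr j) (hK.ne_top _))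
  refine continuous_iff_continuousAt.2 fun y => ?_
  exact (EReal.continuousAt_add (p := (J t, ∑ j, (r j : EReal) * K (t - y j))) (Or.inl ht)
    (Or.inr (h.2 y))).comp
    (f := fun y : Fin n → ℝ => (J t, ∑ j, (r j : EReal) * K (t - y j)))
    (continuous_const.prodMk h.1).continuousAt

lemma lowerSemicontinuous_sSup_sumTrans (hK : MonotoneKernel K) (hr : ∀ j, 0 < r j)
    (hJ : ∀ t, J t ≠ ⊤) :
    LowerSemicontinuous (fun y : Fin n → ℝ => sSup (range (SumTrans K J r y))) := by
  simp only [sSup_range]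
  exact lowerSemicontinuous_iSup fun t => (continuous_sumTrans hK hr (hJ t)).lowerSemicontinuous

lemma sumTrans_le_sumTrans (hr : ∀ j, 0 < r j) {y z : Fin n → ℝ} {t : ℝ}
    (h : ∀ j, K (t - y j) ≤ K (t - z j)) : SumTrans K J r y t ≤ SumTrans K J r z t := by
  refine add_le_add le_rfl (Finset.sum_le_sum fun j _ => ?_)
  exact mul_le_mul_of_nonneg_left (h j) (by exact_mod_cast (hr j).le)

lemma sumTrans_le_of_le (hK : MonotoneKernel K) (hr : ∀ j, 0 < r j) {y : Fin n → ℝ}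
    {t C L : ℝ} (ht : t ≠ 0) (h : ∀ j, K (t - y j) ≤ (((K t).toReal + C : ℝ) : EReal))
    (hL : J t + ((∑ j, r j : ℝ) : EReal) * K t ≤ ((L - (∑ j, r j) * C : ℝ) : EReal)) :
    SumTrans K J r y t ≤ L := by
  have hsum : ∑ j, (r j : EReal) * K (t - y j) ≤
      (((∑ j, r j) * (K t).toReal + (∑ j, r j) * C : ℝ) : EReal) := by
    calc ∑ j, (r j : EReal) * K (t - y j)
        ≤ ∑ j, ((r j * ((K t).toReal + C) : ℝ) : EReal) := by
          refine Finset.sum_le_sum fun j _ => ?_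
          rw [EReal.coe_mul]
          exact mul_le_mul_of_nonneg_left (h j) (by exact_mod_cast (hr j).le)
      _ = _ := by rw [EReal.sum_coe, ← Finset.sum_mul, mul_add]
  refine (add_le_add le_rfl hsum).trans ?_
  rw [EReal.coe_add, ← add_assoc, EReal.coe_mul, hK.coe_toReal ht]
  refine (add_le_add hL le_rfl).trans ?_
  rw [← EReal.coe_add, sub_add_cancel]

lemma le_sumTrans_of_le (hr : ∀ j, 0 < r j) {y u : Fin n → ℝ} {t a : ℝ}
    (ha : (a : EReal) ≤ J t) (h : ∀ j, (u j : EReal) ≤ K (t - y j)) :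
    ((a + ∑ j, r j * u j : ℝ) : EReal) ≤ SumTrans K J r y t := by
  rw [EReal.coe_add, ← EReal.sum_coe]
  refine add_le_add ha (Finset.sum_le_sum fun j _ => ?_)
  rw [EReal.coe_mul]
  exact mul_le_mul_of_nonneg_left (h j) (by exact_mod_cast (hr j).le)

end SumTrans

/-- A finite set with more than `n` points has, uniformly in the position of `n` nodes, a point
that is at distance at least `δ` from all the nodes. -/
lemma exists_uniform_separation {n : ℕ} {S : Finset ℝ} (hS : n < S.card) :
    ∃ δ : ℝ, 0 < δ ∧ ∀ y : Fin n → ℝ, ∃ t ∈ S, ∀ j, δ ≤ |t - y j| := by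
  classical
  have hev : ∀ᶠ δ : ℝ in 𝓝[>] 0, ∀ p ∈ S.offDiag, δ < |p.1 - p.2| / 2 := by
    rw [Finset.eventually_all]
    intro p hp
    have hp' : 0 < |p.1 - p.2| / 2 :=
      half_pos (abs_pos.2 (sub_ne_zero.2 (Finset.mem_offDiag.1 hp).2.2))
    filter_upwards [Ioo_mem_nhdsGT hp'] with x hx using hx.2
  obtain ⟨δ, hδ, hδ0⟩ := (hev.and self_mem_nhdsWithin).exists
  refine ⟨δ, hδ0, fun y => ?_⟩
  by_contra! hcon
  have : Nonempty (Fin n) := by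
    obtain ⟨t, ht⟩ := Finset.card_pos.1 (Nat.zero_lt_of_lt hS)
    exact ⟨(hcon t ht).choose⟩
  choose! φ hφ using hcon
  obtain ⟨s, hs, t, ht, hne, he⟩ := Finset.exists_ne_map_eq_of_card_lt_of_maps_to
    (t := (Finset.univ : Finset (Fin n))) (f := φ) (by simpa using hS) (by simp)
  have h1 := hδ (s, t) (Finset.mem_offDiag.2 ⟨hs, ht, hne⟩)
  have h2 := hφ s hs
  have h3 := hφ t ht
  rw [← he, abs_sub_comm] at h3
  have h4 := abs_sub_le s (y (φ s)) t
  simp only at h1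
  linarith

/-- the minimax is attained: there exists `w ∈ S^∞` with
`m̄(w) = M(S^∞) = inf_{y ∈ S^∞} sup_{t ∈ ℝ} F(y, t)`. -/
theorem minimax_attained (K J : ℝ → EReal) (hK : MonotoneKernel K)
    (n : ℕ) (hn : 0 < n) (r : Fin n → ℝ) (hr : ∀ j, 0 < r j)
    (hJ : IsFieldFn n J) (hadm : IsAdmissible K J (∑ j, r j)) :
    ∃ w : Fin n → ℝ, Monotone w ∧
      sSup (range (SumTrans K J r w)) =
        sInf ((fun y : Fin n → ℝ => sSup (range (SumTrans K J r y))) ''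
          {y | Monotone y}) := by
  have hJtop : ∀ t, J t ≠ ⊤ := by
    obtain ⟨c, hc⟩ := hJ.1
    exact fun t => ((hc t).trans_lt (EReal.coe_lt_top c)).ne
  set m : (Fin n → ℝ) → EReal := fun y => sSup (range (SumTrans K J r y))
  have hle : ∀ y t, SumTrans K J r y t ≤ m y := fun y t => le_sSup (mem_range_self t)
  suffices h : ∃ w, Monotone w ∧ ∀ y, Monotone y → m w ≤ m y by
    obtain ⟨w, hw, hmin⟩ := h
    refine ⟨w, hw, le_antisymm (le_sInf ?_) (sInf_le ⟨w, hw, rfl⟩)⟩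
    rintro _ ⟨y, hy, rfl⟩
    exact hmin y hy
  by_cases htop : ∀ y, Monotone y → m y = ⊤
  · exact ⟨0, monotone_const, fun y hy => (htop y hy).symm ▸ le_top⟩
  push Not at htop
  obtain ⟨y₀, hy₀, hy₀top⟩ := htop
  obtain ⟨U, hU⟩ : ∃ U : ℝ, m y₀ ≤ U := ⟨_, EReal.le_coe_toReal hy₀top⟩
  obtain ⟨S, hS, hSbot⟩ := hJ.2
  obtain ⟨δ, hδ, hsep⟩ := exists_uniform_separation hS
  obtain ⟨a, ha⟩ : ∃ a : ℝ, ∀ t ∈ S, (a : EReal) ≤ J t := by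
    obtain ⟨a, ha⟩ := (S.image fun t => (J t).toReal).bddBelow
    refine ⟨a, fun t ht => ?_⟩
    rw [← EReal.coe_toReal (hJtop t) (hSbot t ht), EReal.coe_le_coe_iff]
    exact ha (Finset.mem_coe.2 (Finset.mem_image_of_mem _ ht))
  obtain ⟨A, hA⟩ : ∃ A : ℝ, ∀ t ∈ S, |t| ≤ A := by
    obtain ⟨A, hA⟩ := (S.image fun t => |t|).bddAbove
    exact ⟨A, fun t ht => hA (Finset.mem_coe.2 (Finset.mem_image_of_mem _ ht))⟩
  obtain ⟨κ, hκ0, hκ⟩ : ∃ κ : ℝ, κ ≤ 0 ∧ ∀ s, δ ≤ |s| → (κ : EReal) ≤ K s := by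
    refine ⟨min 0 (min (K δ).toReal (K (-δ)).toReal), min_le_left _ _, fun s hs => ?_⟩
    rcases le_abs'.1 hs with h | h
    · refine le_trans ?_ (hK.le_of_nonpos (neg_nonpos.2 hδ.le) h)
      rw [← hK.coe_toReal (neg_ne_zero.2 hδ.ne'), EReal.coe_le_coe_iff]
      exact (min_le_right _ _).trans (min_le_right _ _)
    · refine le_trans ?_ (hK.le_of_nonneg hδ.le h)
      rw [← hK.coe_toReal hδ.ne', EReal.coe_le_coe_iff]
      exact (min_le_right _ _).trans (min_le_left _ _)
  set R := ∑ j, r j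
  set L : ℝ := a + R * κ
  have hlow : ∀ y, (L : EReal) ≤ m y := by
    intro y
    obtain ⟨t, htS, ht⟩ := hsep y
    refine le_trans ?_ (hle y t)
    have := le_sumTrans_of_le hr (u := fun _ => κ) (ha t htS) fun j => hκ _ (ht j)
    rwa [← Finset.sum_mul] at this
  set V : ℝ := ∑ j, |U - L| / r j
  have hVj : ∀ j, U - L ≤ r j * V := by
    intro j
    have h1 : |U - L| / r j ≤ V :=
      Finset.single_le_sum (f := fun j => |U - L| / r j)
        (fun i _ => div_nonneg (abs_nonneg _) (hr i).le) (Finset.mem_univ j)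
    rw [div_le_iff₀ (hr j)] at h1
    linarith [le_abs_self (U - L)]
  -- a node at which the kernel is large on all of `S` makes the maximum at least `U`
  have hbad : ∀ y j, (∀ t ∈ S, (V : EReal) ≤ K (t - y j)) → (U : EReal) ≤ m y := by
    intro y i hi
    obtain ⟨t, htS, ht⟩ := hsep y
    refine le_trans ?_ (hle y t)
    have h := le_sumTrans_of_le (y := y) hr (u := fun j => κ + if j = i then V - κ else 0)
      (ha t htS) (by
        intro j
        by_cases hji : j = i
        · subst hji
          simpa only [if_true, add_sub_cancel] using hi t htS
        · simpa only [hji, if_false, add_zero] using hκ _ (ht j))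
    refine le_trans ?_ h
    simp only [mul_add, Finset.sum_add_distrib, ← Finset.sum_mul, mul_ite, mul_zero,
      Finset.sum_ite_eq', Finset.mem_univ, if_true, EReal.coe_le_coe_iff]
    nlinarith [hVj i, hr i]
  obtain ⟨C₁, hC₁, hdich₁⟩ := hK.tail_dichotomy A V
  obtain ⟨C₂, hC₂, hdich₂⟩ := hK.comp_neg.tail_dichotomy A V
  set C := max C₁ C₂
  obtain ⟨b, hb1, hby₀, hb⟩ : ∃ b : ℝ, 1 ≤ b ∧ (∀ j, |y₀ j| ≤ b) ∧
      ∀ t, b ≤ |t| → J t + (R : EReal) * K t ≤ ((L - R * C : ℝ) : EReal) := by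
    have hev := hadm.eventually (eventually_le_nhds (EReal.bot_lt_coe (L - R * C)))
    rw [← Metric.cobounded_eq_cocompact, ← comap_norm_atTop, eventually_comap,
      eventually_atTop] at hev
    obtain ⟨b, hb⟩ := hev
    obtain ⟨d, hd⟩ := (finite_range fun j => |y₀ j|).bddAbove
    exact ⟨max 1 (max b d), le_max_left _ _,
      fun j => (hd (mem_range_self j)).trans ((le_max_right _ _).trans (le_max_right _ _)),
      fun t ht => hb |t| (((le_max_left _ _).trans (le_max_right _ _)).trans ht) t rfl⟩
  -- on the compact box of nodes in `[-b, b]` the minimum is attained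
  have hcomp : IsCompact ({y | Monotone y} ∩ univ.pi fun _ : Fin n => Icc (-b) b) := by
    refine (isCompact_univ_pi fun _ => isCompact_Icc).inter_left ?_
    exact isClosed_monotone
  have hmem : y₀ ∈ {y | Monotone y} ∩ univ.pi fun _ : Fin n => Icc (-b) b :=
    ⟨hy₀, fun j _ => abs_le.1 (hby₀ j)⟩
  obtain ⟨w, ⟨hw, -⟩, hmin⟩ := LowerSemicontinuousOn.exists_isMinOn ⟨y₀, hmem⟩ hcomp
    ((lowerSemicontinuous_sSup_sumTrans hK hr hJtop).lowerSemicontinuousOn _)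
  have hwU : m w ≤ U := (hmin hmem).trans hU
  refine ⟨w, hw, fun y hy => ?_⟩
  by_cases hfar : ∃ j, ∀ t ∈ S, (V : EReal) ≤ K (t - y j)
  · obtain ⟨j, hj⟩ := hfar
    exact hwU.trans (hbad y j hj)
  have hgood₁ : ∀ j t, 1 ≤ t → 0 ≤ t - y j →
      K (t - y j) ≤ (((K t).toReal + C : ℝ) : EReal) := by
    intro j t ht h0
    rcases hdich₁ (-y j) with h | h
    · refine (h t ht h0).trans ?_
      rw [EReal.coe_le_coe_iff]
      linarith [le_max_left C₁ C₂]
    · exact absurd ⟨j, fun t ht => h _ (by linarith [neg_le_of_abs_le (hA t ht)])⟩ hfar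
  have hgood₂ : ∀ j t, t ≤ -1 → t - y j ≤ 0 →
      K (t - y j) ≤ (((K t).toReal + C : ℝ) : EReal) := by
    intro j t ht h0
    rcases hdich₂ (y j) with h | h
    · have h' := h (-t) (by linarith) (by linarith)
      simp only [neg_neg, neg_add'] at h'
      refine h'.trans ?_
      rw [EReal.coe_le_coe_iff]
      linarith [le_max_right C₁ C₂]
    · refine absurd ⟨j, fun t ht => ?_⟩ hfar
      simpa using h (y j - t) (by linarith [le_of_abs_le (hA t ht)])
  have hselfC : ∀ t, t ≠ 0 → K t ≤ (((K t).toReal + C : ℝ) : EReal) := by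
    intro t ht
    nth_rw 1 [← hK.coe_toReal ht]
    rw [EReal.coe_le_coe_iff]
    exact le_add_of_nonneg_right (hC₁.trans (le_max_left _ _))
  -- moving the nodes into `[-b, b]` does not increase the maximum
  set c : Fin n → ℝ := fun j => max (-b) (min b (y j))
  have hcmem : ∀ j, -b ≤ c j ∧ c j ≤ b := fun j =>
    ⟨le_max_left _ _, max_le (by linarith) (min_le_left _ _)⟩
  have hcle : ∀ j x, x ≤ b → x ≤ y j → x ≤ c j := fun j x h1 h2 =>
    (le_min h1 h2).trans (le_max_right _ _)
  have hcge : ∀ j x, -b ≤ x → y j ≤ x → c j ≤ x := fun j x h1 h2 =>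
    max_le h1 ((min_le_right _ _).trans h2)
  have hcmono : Monotone c := fun i j hij =>
    max_le_max le_rfl (min_le_min le_rfl (hy hij))
  refine (hmin ⟨hcmono, fun j _ => hcmem j⟩).trans (sSup_le ?_)
  rintro _ ⟨t, rfl⟩
  rcases le_or_gt b |t| with hbt | hbt
  · have ht0 : t ≠ 0 := abs_pos.1 (by linarith)
    refine (sumTrans_le_of_le hK hr ht0 (fun j => ?_) (hb t hbt)).trans (hlow y)
    rcases le_abs'.1 hbt with ht | ht
    · have h0 : t - c j ≤ 0 := by linarith [hcmem j]
      rcases le_or_gt (y j) 0 with hyj | hyj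
      · exact (hK.le_of_nonpos h0 (by linarith [hcge j 0 (by linarith) hyj])).trans
          (hselfC t ht0)
      · exact (hK.le_of_nonpos h0 (by linarith [hcge j (y j) (by linarith) le_rfl])).trans
          (hgood₂ j t (by linarith) (by linarith))
    · have h0 : 0 ≤ t - c j := by linarith [hcmem j]
      rcases le_or_gt 0 (y j) with hyj | hyj
      · exact (hK.le_of_nonneg h0 (by linarith [hcle j 0 (by linarith) hyj])).trans
          (hselfC t ht0)
      · exact (hK.le_of_nonneg h0 (by linarith [hcle j (y j) (by linarith) le_rfl])).trans
          (hgood₁ j t (by linarith) (by linarith))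
  · obtain ⟨hbt1, hbt2⟩ := abs_lt.1 hbt
    refine (sumTrans_le_sumTrans hr fun j => ?_).trans (hle y t)
    rcases le_total t (y j) with h | h
    · refine hK.le_of_nonpos (by linarith [hcle j t hbt2.le h]) ?_
      have : c j ≤ y j := hcge j _ (by linarith) le_rfl
      linarith
    · refine hK.le_of_nonneg (by linarith [hcge j t hbt1.le h]) ?_
      have : y j ≤ c j := hcle j _ (by linarith) le_rfl
      linarith
end
end
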